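/- Let n ≥ 3 be an integer, let 0 < q < 1 and let x ∈ [0,1]. Then D_n^q(e_0)(x) = 1; in particular all the series and q-integrals defining D_n^q(e_0)(x) converge. -/

import Mathlib

/-- The `q`-integer `[n]_q = 1 + q + ⋯ + q^{n-1}`. -/
noncomputable def qInt (q : ℝ) (n : ℕ) : ℝ := ∑ k ∈ Finset.range n, q ^ k

/-- The `q`-factorial `[n]_q!`. -/
noncomputable def qFact (q : ℝ) (n : ℕ) : ℝ := ∏ k ∈ Finset.range n, qInt q (k + 1)

/-- The `q`-binomial coefficient `[m choose r]_q`. -/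
noncomputable def qBinom (q : ℝ) (m r : ℕ) : ℝ := qFact q m / (qFact q r * qFact q (m - r))

/-- The Jackson `q`-integral of `g` over `[0,1]`. -/
noncomputable def qIntegral (q : ℝ) (g : ℝ → ℝ) : ℝ := (1 - q) * ∑' m : ℕ, q ^ m * g (q ^ m)

/-- The `q`-shifted factorial `(t;q)_n`. -/
noncomputable def qShift (q t : ℝ) (n : ℕ) : ℝ := ∏ j ∈ Finset.range n, (1 - t * q ^ j)

/-- The `q`-beta function `B_q(m,n)`. -/
noncomputable def qBeta (q : ℝ) (m n : ℕ) : ℝ :=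
  qIntegral q (fun t => t ^ (m - 1) * qShift q (q * t) (n - 1))

/-- The weight `m_{n,k,q}(x) = (x;q)_{n+1} [n+k choose k]_q x^k`. -/
noncomputable def mWeight (q : ℝ) (n k : ℕ) (x : ℝ) : ℝ :=
  qShift q x (n + 1) * qBinom q (n + k) k * x ^ k

/-- The `q`-MKZ–Durrmeyer operator. -/
noncomputable def Durr (q : ℝ) (n : ℕ) (f : ℝ → ℝ) (x : ℝ) : ℝ :=
  if x = 1 then f 1
  else mWeight q n 0 x * f 0 +
    ∑' k : ℕ, mWeight q n (k + 1) x * (1 / qBeta q n (k + 1)) *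
      qIntegral q (fun t => t ^ k * qShift q (q * t) (n - 1) * f t)

open Finset in
theorem qInt_succ_pos {q : ℝ} (hq0 : 0 < q) (n : ℕ) : 0 < qInt q (n + 1) :=
  sum_pos (fun _ _ => pow_pos hq0 _) nonempty_range_add_one

theorem qFact_pos {q : ℝ} (hq0 : 0 < q) (n : ℕ) : 0 < qFact q n :=
  Finset.prod_pos fun k _ => qInt_succ_pos hq0 k

theorem qFact_succ (q : ℝ) (n : ℕ) : qFact q (n + 1) = qFact q n * qInt q (n + 1) :=
  Finset.prod_range_succ _ n

theorem qInt_add (q : ℝ) (m n : ℕ) : qInt q (m + n) = qInt q m + q ^ m * qInt q n := by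
  simp only [qInt, Finset.sum_range_add, pow_add, Finset.mul_sum]

theorem qShift_succ (q t : ℝ) (n : ℕ) : qShift q t (n + 1) = qShift q t n * (1 - t * q ^ n) :=
  Finset.prod_range_succ _ n

/-- The series of the Jackson integral of `t ^ a * (qt;q)_n`. -/
theorem hasSum_qIntegral_pow_mul_qShift {q : ℝ} (hq0 : 0 < q) (hq1 : q < 1) (n a : ℕ) :
    HasSum (fun m : ℕ => q ^ m * ((q ^ m) ^ a * qShift q (q * q ^ m) n))
      (qFact q a * qFact q n / qFact q (a + n + 1) / (1 - q)) := by
  have h1q : 1 - q ≠ 0 := by linarith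
  induction n generalizing a with
  | zero =>
    have hg : HasSum (fun m : ℕ => (q ^ (a + 1)) ^ m) (1 - q ^ (a + 1))⁻¹ :=
      hasSum_geometric_of_lt_one (by positivity) (pow_lt_one₀ hq0.le hq1 (by omega))
    have hq : qInt q (a + 1) * (1 - q) = 1 - q ^ (a + 1) := geom_sum_mul_neg q (a + 1)
    have hv : qFact q a * qFact q 0 / qFact q (a + 0 + 1) / (1 - q) = (1 - q ^ (a + 1))⁻¹ := by
      have := (qFact_pos hq0 a).ne'
      have := (qInt_succ_pos hq0 a).ne'
      rw [← hq, add_zero, qFact_succ, show qFact q 0 = 1 from Finset.prod_range_zero _]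
      field_simp
    rw [hv]
    convert! hg using 2 with m
    simp only [qShift, Finset.prod_range_zero]
    ring
  | succ n ih =>
    have hs := (ih a).sub ((ih (a + 1)).mul_left (q ^ (n + 1)))
    convert! hs using 1
    · funext m
      rw [qShift_succ]
      ring
    · have hadd : qInt q (a + n + 1 + 1) = qInt q (n + 1) + q ^ (n + 1) * qInt q (a + 1) := by
        rw [← qInt_add]
        congr 1
        omega
      have := (qFact_pos hq0 (a + n + 1)).ne'
      have := (qInt_succ_pos hq0 (a + n + 1)).ne'
      rw [← add_assoc a n 1, add_right_comm a 1 n, qFact_succ q (a + n + 1), qFact_succ q n,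
        qFact_succ q a]
      field_simp
      rw [hadd]
      ring

theorem qIntegral_pow_mul_qShift {q : ℝ} (hq0 : 0 < q) (hq1 : q < 1) (n a : ℕ) :
    qIntegral q (fun t => t ^ a * qShift q (q * t) n) =
      qFact q a * qFact q n / qFact q (a + n + 1) := by
  have h1q : 1 - q ≠ 0 := by linarith
  rw [qIntegral, (hasSum_qIntegral_pow_mul_qShift hq0 hq1 n a).tsum_eq]
  field_simp

theorem qBinom_add_self {q : ℝ} (n k : ℕ) :
    qBinom q (n + k) k = qFact q (n + k) / (qFact q k * qFact q n) := by
  rw [qBinom, Nat.add_sub_cancel]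

theorem qBinom_zero_right {q : ℝ} (hq0 : 0 < q) (n : ℕ) : qBinom q n 0 = 1 := by
  have := (qFact_pos hq0 n).ne'
  simp [qBinom, show qFact q 0 = 1 from Finset.prod_range_zero _, this]

/-- The `q`-Pascal rule. -/
theorem qBinom_pascal {q : ℝ} (hq0 : 0 < q) (n k : ℕ) :
    qBinom q (n + 1 + (k + 1)) (k + 1) =
      qBinom q (n + (k + 1)) (k + 1) + q ^ (n + 1) * qBinom q (n + 1 + k) k := by
  have hadd : qInt q (n + k + 1 + 1) = qInt q (n + 1) + q ^ (n + 1) * qInt q (k + 1) := by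
    rw [← qInt_add]
    congr 1
    omega
  have := (qFact_pos hq0 k).ne'
  have := (qFact_pos hq0 n).ne'
  have := (qInt_succ_pos hq0 k).ne'
  have := (qInt_succ_pos hq0 n).ne'
  simp only [qBinom_add_self]
  rw [show n + 1 + (k + 1) = n + k + 1 + 1 by omega, show n + (k + 1) = n + k + 1 by omega,
    show n + 1 + k = n + k + 1 by omega, qFact_succ q (n + k + 1), qFact_succ q n, qFact_succ q k,
    hadd]
  field_simp

theorem sum_range_qBinom_mul_pow {q : ℝ} (hq0 : 0 < q) (x : ℝ) (n k : ℕ) :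
    ∑ j ∈ Finset.range (k + 1), qBinom q (n + j) j * x ^ j * (x * q ^ (n + 1)) ^ (k - j) =
      qBinom q (n + 1 + k) k * x ^ k := by
  induction k with
  | zero => simp [qBinom_zero_right hq0]
  | succ k ih =>
    have h : ∀ j ∈ Finset.range (k + 1),
        qBinom q (n + j) j * x ^ j * (x * q ^ (n + 1)) ^ (k + 1 - j) =
          (x * q ^ (n + 1)) * (qBinom q (n + j) j * x ^ j * (x * q ^ (n + 1)) ^ (k - j)) := by
      intro j hj
      rw [Nat.succ_sub (Finset.mem_range_succ_iff.mp hj), pow_succ]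
      ring
    rw [Finset.sum_range_succ, Finset.sum_congr rfl h, ← Finset.mul_sum, ih, qBinom_pascal hq0,
      Nat.sub_self]
    ring

/-- The `q`-binomial series. -/
theorem hasSum_qBinom_mul_pow {q : ℝ} (hq0 : 0 < q) (hq1 : q < 1) {x : ℝ} (hx0 : 0 ≤ x)
    (hx1 : x < 1) (n : ℕ) :
    HasSum (fun k : ℕ => qBinom q (n + k) k * x ^ k) (qShift q x (n + 1))⁻¹ := by
  induction n with
  | zero =>
    convert! hasSum_geometric_of_lt_one hx0 hx1 using 2 with k
    · have := (qFact_pos hq0 k).ne'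
      simp [qBinom, show qFact q 0 = 1 from Finset.prod_range_zero _, this]
    · simp [qShift]
  | succ n ih =>
    have hy0 : 0 ≤ x * q ^ (n + 1) := by positivity
    have hy1 : x * q ^ (n + 1) < 1 :=
      (mul_le_of_le_one_right hx0 (pow_le_one₀ hq0.le hq1.le)).trans_lt hx1
    have hg := hasSum_geometric_of_lt_one hy0 hy1
    have hs := hasSum_sum_range_mul_of_summable_norm ih.summable.norm hg.summable.norm
    rw [ih.tsum_eq, hg.tsum_eq, ← mul_inv, ← qShift_succ] at hs
    simpa only [sum_range_qBinom_mul_pow hq0] using hs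

theorem hasSum_mWeight {q : ℝ} (hq0 : 0 < q) (hq1 : q < 1) {x : ℝ} (hx0 : 0 ≤ x)
    (hx1 : x < 1) (n : ℕ) : HasSum (fun k : ℕ => mWeight q n k x) 1 := by
  have hne : qShift q x (n + 1) ≠ 0 := by
    refine Finset.prod_ne_zero_iff.mpr fun j _ => sub_ne_zero.mpr (ne_of_gt ?_)
    exact (mul_le_of_le_one_right hx0 (pow_le_one₀ hq0.le hq1.le)).trans_lt hx1
  have h := (hasSum_qBinom_mul_pow hq0 hq1 hx0 hx1 n).mul_left (qShift q x (n + 1))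
  rw [mul_inv_cancel₀ hne] at h
  simpa only [mWeight, mul_assoc] using h

theorem mWeight_one (q : ℝ) (n k : ℕ) : mWeight q n k 1 = 0 := by
  have : qShift q 1 (n + 1) = 0 :=
    Finset.prod_eq_zero (Finset.mem_range.mpr n.succ_pos) (by simp)
  simp [mWeight, this]

/-- The `q`-beta function is symmetric and nonzero, so it cancels the Durrmeyer integral of `1`. -/
theorem one_div_qBeta_mul_qIntegral {q : ℝ} (hq0 : 0 < q) (hq1 : q < 1) (n k : ℕ) :
    1 / qBeta q n (k + 1) * qIntegral q (fun t => t ^ k * qShift q (q * t) (n - 1) * 1) = 1 := by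
  have := (qFact_pos hq0 k).ne'
  have := (qFact_pos hq0 (n - 1)).ne'
  have := (qFact_pos hq0 (k + (n - 1) + 1)).ne'
  simp only [mul_one, qBeta, Nat.add_sub_cancel, qIntegral_pow_mul_qShift hq0 hq1]
  rw [add_comm (n - 1) k]
  field_simp

theorem stmt3 (q : ℝ) (hq0 : 0 < q) (hq1 : q < 1) (n : ℕ) (hn : 3 ≤ n)
    (x : ℝ) (hx : x ∈ Set.Icc (0 : ℝ) 1) :
    -- the `q`-integrals appearing in `D_n^q(e_0)(x)` converge
    (∀ k : ℕ, Summable (fun m : ℕ => q ^ m * ((q ^ m) ^ k * qShift q (q * q ^ m) (n - 1) * 1))) ∧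
    -- the `q`-integrals defining the `q`-beta normalizing constants converge
    (∀ k : ℕ, Summable (fun m : ℕ => q ^ m * ((q ^ m) ^ (n - 1) * qShift q (q * q ^ m) ((k + 1) - 1)))) ∧
    -- the series over `k` converges
    Summable (fun k : ℕ => mWeight q n (k + 1) x * (1 / qBeta q n (k + 1)) *
      qIntegral q (fun t => t ^ k * qShift q (q * t) (n - 1) * 1)) ∧
    Durr q n (fun _ => 1) x = 1 := by
  have hw : (fun k : ℕ => mWeight q n (k + 1) x * (1 / qBeta q n (k + 1)) *
      qIntegral q (fun t => t ^ k * qShift q (q * t) (n - 1) * 1)) =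
      fun k => mWeight q n (k + 1) x := by
    funext k
    rw [mul_assoc, one_div_qBeta_mul_qIntegral hq0 hq1, mul_one]
  refine ⟨fun k => ?_, fun k => ?_, ?_, ?_⟩
  · simpa only [mul_one] using (hasSum_qIntegral_pow_mul_qShift hq0 hq1 (n - 1) k).summable
  · exact (hasSum_qIntegral_pow_mul_qShift hq0 hq1 k (n - 1)).summable
  · rw [hw]
    rcases hx.2.eq_or_lt with rfl | hx1
    · simpa only [mWeight_one] using summable_zero
    · exact (summable_nat_add_iff 1).mpr (hasSum_mWeight hq0 hq1 hx.1 hx1 n).summable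
  · unfold Durr
    split_ifs with h1
    · rfl
    · have hs := hasSum_mWeight hq0 hq1 hx.1 (lt_of_le_of_ne hx.2 h1) n
      rw [hw, mul_one, ← hs.summable.tsum_eq_zero_add, hs.tsum_eq]
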